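/- arXiv:1304.5219 — 3 statements merged into one kernel-verified Lean document; each statement's English description precedes it below -/
import Mathlib

section
/- Let X be a compact ultrametric space and p ∈ [1,∞). Then (P(X), W_p^p) is affinely isometric to a convex subset of ℓ¹: there exists a map φ from the set P(X) of Borel probability measures on X to the real sequence space ℓ¹ such that (i) φ((1−t)·μ + t·ν) = (1−t)·φ(μ) + t·φ(ν) for all μ, ν ∈ P(X) and t ∈ [0,1]; (ii) ‖φ(μ) − φ(ν)‖_{ℓ¹} = W_p(μ,ν)^p for all μ, ν ∈ P(X); and (iii) the image of φ is a convex subset of ℓ¹. -/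
open MeasureTheory
open scoped ENNReal NNReal

/-- A coupling of `μ` and `ν`. -/
def IsCoupling {X : Type*} [MeasurableSpace X] (π : Measure (X × X)) (μ ν : Measure X) : Prop :=
  IsProbabilityMeasure π ∧ π.map Prod.fst = μ ∧ π.map Prod.snd = ν

/-- The `L^p` Wasserstein distance between two (probability) measures. -/
noncomputable def Wp {X : Type*} [MetricSpace X] [MeasurableSpace X] (p : ℝ)
    (μ ν : Measure X) : ℝ :=
  sInf {c : ℝ | ∃ π : Measure (X × X), IsCoupling π μ ν ∧
      c = ∫ ab, dist ab.1 ab.2 ^ p ∂π} ^ (1 / p)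

instance : Fact ((1 : ℝ≥0∞) ≤ 1) := ⟨le_rfl⟩

/-- The pairs of points separated by `B`. -/
def separatedPairs {X : Type*} (B : Set X) : Set (X × X) :=
  B ×ˢ Bᶜ ∪ Bᶜ ×ˢ B

/-- The positive scales `s` at which `B` is the `ρ`-ball of radius `s` around each of its points. -/
def ballScales {X : Type*} (ρ : X → X → ℝ) (B : Set X) : Set ℝ :=
  {s | 0 < s ∧ ∀ x ∈ B, ∀ y, y ∈ B ↔ ρ x y ≤ s}

lemma ordConnected_ballScales {X : Type*} (ρ : X → X → ℝ) (B : Set X) :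
    (ballScales ρ B).OrdConnected := by
  refine ⟨fun s hs t ht u hu => ⟨hs.1.trans_le hu.1, fun x hx y => ⟨fun hy => ?_, fun hy => ?_⟩⟩⟩
  · exact ((hs.2 x hx y).1 hy).trans hu.1
  · exact (ht.2 x hx y).2 (hy.trans hu.2)

lemma measurableSet_ballScales {X : Type*} (ρ : X → X → ℝ) (B : Set X) :
    MeasurableSet (ballScales ρ B) :=
  (ordConnected_ballScales ρ B).measurableSet

/-- A continuous ultrametric cost on a topological space. -/
structure IsUltraCost {X : Type*} [TopologicalSpace X] (ρ : X → X → ℝ) : Prop where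
  continuous : Continuous fun z : X × X => ρ z.1 z.2
  self : ∀ x, ρ x x = 0
  symm : ∀ x y, ρ x y = ρ y x
  ultra : ∀ x y z, ρ x z ≤ max (ρ x y) (ρ y z)

namespace IsUltraCost

variable {X : Type*} [TopologicalSpace X] {ρ : X → X → ℝ}

lemma nonneg (hρ : IsUltraCost ρ) (x y : X) : 0 ≤ ρ x y := by
  have h := hρ.ultra x y x
  rwa [hρ.self, hρ.symm y x, max_self] at h

lemma isClopen_ball (hρ : IsUltraCost ρ) (x : X) {s : ℝ} (hs : 0 < s) :
    IsClopen {y | ρ x y ≤ s} := by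
  have hc : ∀ x, Continuous (ρ x) := fun x =>
    hρ.continuous.comp (by fun_prop : Continuous fun y => (x, y))
  refine ⟨isClosed_le (hc x) continuous_const, isOpen_iff_mem_nhds.2 fun z hz => ?_⟩
  have hlt : ρ z z < s := by rw [hρ.self]; exact hs
  filter_upwards [(isOpen_lt (hc z) continuous_const).mem_nhds hlt] with y hy
  exact (hρ.ultra x z y).trans (max_le hz (le_of_lt hy))

lemma mem_ballScales_ball (hρ : IsUltraCost ρ) (x : X) {s : ℝ} (hs : 0 < s) :
    s ∈ ballScales ρ {y | ρ x y ≤ s} := by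
  refine ⟨hs, fun a ha y => ⟨fun hy => ?_, fun hy => ?_⟩⟩
  · refine (hρ.ultra a x y).trans (max_le ?_ hy)
    rw [hρ.symm]; exact ha
  · exact (hρ.ultra x a y).trans (max_le ha hy)

/-- At a fixed scale below `ρ x y`, the pair `(x, y)` is separated by exactly two balls. -/
lemma tsum_indicator_ballScales (hρ : IsUltraCost ρ) (x y : X) (s : ℝ) :
    ∑' b : TopologicalSpace.Clopens X, (ballScales ρ (b : Set X)).indicator
        (fun _ => (separatedPairs (b : Set X)).indicator (1 : X × X → ℝ≥0∞) (x, y)) s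
      = (Set.Ioo 0 (ρ x y)).indicator (fun _ => 2) s := by
  classical
  by_cases hs : s ∈ Set.Ioo 0 (ρ x y)
  · rw [Set.indicator_of_mem hs]
    let b_x : TopologicalSpace.Clopens X := ⟨_, hρ.isClopen_ball x hs.1⟩
    let b_y : TopologicalSpace.Clopens X := ⟨_, hρ.isClopen_ball y hs.1⟩
    have hx : (b_x : Set X) = {z | ρ x z ≤ s} := rfl
    have hy : (b_y : Set X) = {z | ρ y z ≤ s} := rfl
    have hxx : x ∈ (b_x : Set X) := by rw [hx]; simpa [hρ.self] using hs.1.le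
    have hyy : y ∈ (b_y : Set X) := by rw [hy]; simpa [hρ.self] using hs.1.le
    have hyx : y ∉ (b_x : Set X) := by rw [hx]; simpa using hs.2
    have hxy : x ∉ (b_y : Set X) := by rw [hy]; simpa [hρ.symm y x] using hs.2
    have hne : b_x ≠ b_y := fun h => hxy (h ▸ hxx)
    have hsx : s ∈ ballScales ρ (b_x : Set X) := hρ.mem_ballScales_ball x hs.1
    have hsy : s ∈ ballScales ρ (b_y : Set X) := hρ.mem_ballScales_ball y hs.1
    have key : ∀ b : TopologicalSpace.Clopens X, (ballScales ρ (b : Set X)).indicator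
        (fun _ => (separatedPairs (b : Set X)).indicator (1 : X × X → ℝ≥0∞) (x, y)) s
        = (if b = b_x then 1 else 0) + (if b = b_y then 1 else 0) := by
      intro b
      by_cases h1 : b = b_x
      · subst h1
        simp [hsx, separatedPairs, hxx, hyx, hne]
      by_cases h2 : b = b_y
      · subst h2
        simp [hsy, separatedPairs, hyy, hxy, hne.symm]
      simp only [h1, h2, if_false, add_zero]
      by_cases hb : s ∈ ballScales ρ (b : Set X)
      · rw [Set.indicator_of_mem hb]
        have hxb : x ∉ (b : Set X) := fun h => h1 (by
          ext z; exact hb.2 x h z)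
        have hyb : y ∉ (b : Set X) := fun h => h2 (by
          ext z; exact hb.2 y h z)
        simp [separatedPairs, hxb, hyb]
      · rw [Set.indicator_of_notMem hb]
    simp_rw [key]
    rw [ENNReal.tsum_add, tsum_ite_eq, tsum_ite_eq]
    norm_num
  · rw [Set.indicator_of_notMem hs, ENNReal.tsum_eq_zero]
    intro b
    by_cases hb : s ∈ ballScales ρ (b : Set X)
    · rw [Set.indicator_of_mem hb]
      refine Set.indicator_of_notMem ?_ _
      have hle : ρ x y ≤ s := not_lt.1 fun h => hs ⟨hb.1, h⟩
      rintro (⟨h1, h2⟩ | ⟨h1, h2⟩)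
      · exact h2 ((hb.2 x h1 y).2 hle)
      · exact h1 ((hb.2 y h2 x).2 (hρ.symm x y ▸ hle))
    · rw [Set.indicator_of_notMem hb]

lemma tsum_volume_ballScales [Countable (TopologicalSpace.Clopens X)] (hρ : IsUltraCost ρ)
    (x y : X) :
    ∑' b : TopologicalSpace.Clopens X, volume (ballScales ρ (b : Set X)) *
        (separatedPairs (b : Set X)).indicator (1 : X × X → ℝ≥0∞) (x, y)
      = 2 * ENNReal.ofReal (ρ x y) := by
  have h := lintegral_tsum (μ := (volume : Measure ℝ))
    (f := fun (b : TopologicalSpace.Clopens X) s => (ballScales ρ (b : Set X)).indicator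
      (fun _ => (separatedPairs (b : Set X)).indicator (1 : X × X → ℝ≥0∞) (x, y)) s)
    (fun b => (measurable_const.indicator (measurableSet_ballScales ρ b)).aemeasurable)
  simp_rw [hρ.tsum_indicator_ballScales x y] at h
  rw [lintegral_indicator_const measurableSet_Ioo, Real.volume_Ioo, sub_zero] at h
  rw [h]
  refine tsum_congr fun b => ?_
  rw [lintegral_indicator_const (measurableSet_ballScales ρ b), mul_comm]

/-- An ultrametric cost is a countable nonnegative combination of cut semimetrics of balls. -/
lemma exists_cut_decomposition [Countable (TopologicalSpace.Clopens X)] (hρ : IsUltraCost ρ) :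
    ∃ (B : ℕ → Set X) (w : ℕ → ℝ≥0), (∀ n, IsClopen (B n)) ∧
      (∀ n, w n ≠ 0 → ∀ a ∈ B n, ∀ b ∈ B n, ∀ c ∉ B n, ρ a b < ρ a c) ∧
      ∀ x y, ∑' n, (w n : ℝ≥0∞) * (separatedPairs (B n)).indicator (1 : X × X → ℝ≥0∞) (x, y)
        = ENNReal.ofReal (ρ x y) := by
  have := Encodable.ofCountable (TopologicalSpace.Clopens X)
  let B : ℕ → Set X := fun n =>
    ⋃ b ∈ Encodable.decode₂ (TopologicalSpace.Clopens X) n, (b : Set X)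
  refine ⟨B, fun n => (volume (ballScales ρ (B n)) / 2).toNNReal, fun n => ?_, fun n hn => ?_,
    fun x y => ?_⟩
  · exact Encodable.iUnion_decode₂_cases (C := IsClopen) isClopen_empty
      fun b : TopologicalSpace.Clopens X => b.isClopen
  · have hv : volume (ballScales ρ (B n)) ≠ 0 := fun h => hn (by simp [h])
    obtain ⟨s, hs⟩ := nonempty_of_measure_ne_zero hv
    intro a ha b hb c hc
    exact ((hs.2 a ha b).1 hb).trans_lt (not_le.1 fun h => hc ((hs.2 a ha c).2 h))
  · have h : ∑' n, volume (ballScales ρ (B n)) *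
        (separatedPairs (B n)).indicator (1 : X × X → ℝ≥0∞) (x, y) = 2 * ENNReal.ofReal (ρ x y) := by
      rw [← hρ.tsum_volume_ballScales x y]
      exact tsum_iUnion_decode₂ (fun b : Set X => volume (ballScales ρ b) *
        (separatedPairs b).indicator (1 : X × X → ℝ≥0∞) (x, y)) (by simp [separatedPairs]) _
    have htop := ENNReal.ne_top_of_tsum_ne_top
      (h ▸ ENNReal.mul_ne_top (by simp) ENNReal.ofReal_ne_top)
    have h2 : ENNReal.ofReal (ρ x y) = 2⁻¹ * (2 * ENNReal.ofReal (ρ x y)) := by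
      rw [← mul_assoc, ENNReal.inv_mul_cancel (by simp) (by simp), one_mul]
    rw [h2, ← h, ← ENNReal.tsum_mul_left]
    refine tsum_congr fun n => ?_
    by_cases hm : (x, y) ∈ separatedPairs (B n)
    · have ht := htop n
      rw [Set.indicator_of_mem hm, Pi.one_apply, mul_one] at ht ⊢
      rw [ENNReal.coe_toNNReal (ENNReal.div_ne_top ht (by simp)), mul_one, mul_comm, div_eq_mul_inv]
    · simp [Set.indicator_of_notMem hm]

end IsUltraCost

lemma integrable_of_continuous_of_compactSpace {Y : Type*} [TopologicalSpace Y] [CompactSpace Y]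
    [MeasurableSpace Y] [OpensMeasurableSpace Y] (μ : Measure Y) [IsFiniteMeasure μ]
    {f : Y → ℝ} (hf : Continuous f) : Integrable f μ :=
  hf.integrable_of_hasCompactSupport (HasCompactSupport.of_compactSpace f)

section Coupling

variable {X : Type*} [MeasurableSpace X]

lemma isCoupling_prod (μ ν : Measure X) [IsProbabilityMeasure μ] [IsProbabilityMeasure ν] :
    IsCoupling (μ.prod ν) μ ν :=
  ⟨inferInstance, by simp, by simp⟩

lemma measurableSet_separatedPairs {B : Set X} (hB : MeasurableSet B) :
    MeasurableSet (separatedPairs B) :=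
  (hB.prod hB.compl).union (hB.compl.prod hB)

lemma IsCoupling.sub_eq {π : Measure (X × X)} {μ ν : Measure X} (h : IsCoupling π μ ν)
    {B : Set X} (hB : MeasurableSet B) :
    μ.real B - ν.real B = π.real (B ×ˢ Bᶜ) - π.real (Bᶜ ×ˢ B) := by
  obtain ⟨_, rfl, rfl⟩ := h
  have h1 : (π.map Prod.fst).real B = π.real (B ×ˢ B) + π.real (B ×ˢ Bᶜ) := by
    rw [map_measureReal_apply measurable_fst hB, ← measureReal_union _ (hB.prod hB.compl)]
    · congr 1; ext ⟨x, y⟩; by_cases hy : y ∈ B <;> simp [hy]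
    · exact Set.disjoint_prod.2 (Or.inr disjoint_compl_right)
  have h2 : (π.map Prod.snd).real B = π.real (B ×ˢ B) + π.real (Bᶜ ×ˢ B) := by
    rw [map_measureReal_apply measurable_snd hB, ← measureReal_union _ (hB.compl.prod hB)]
    · congr 1; ext ⟨x, y⟩; by_cases hx : x ∈ B <;> simp [hx]
    · exact Set.disjoint_prod.2 (Or.inl disjoint_compl_right)
  rw [h1, h2]; ring

lemma measureReal_separatedPairs (π : Measure (X × X)) [IsFiniteMeasure π]
    {B : Set X} (hB : MeasurableSet B) :
    π.real (separatedPairs B) = π.real (B ×ˢ Bᶜ) + π.real (Bᶜ ×ˢ B) :=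
  measureReal_union (Set.disjoint_prod.2 (Or.inl disjoint_compl_right)) (hB.compl.prod hB)

lemma IsCoupling.abs_sub_le {π : Measure (X × X)} {μ ν : Measure X} (h : IsCoupling π μ ν)
    {B : Set X} (hB : MeasurableSet B) :
    |μ.real B - ν.real B| ≤ π.real (separatedPairs B) := by
  have := h.1
  rw [h.sub_eq hB, measureReal_separatedPairs π hB, abs_le]
  constructor <;> linarith [measureReal_nonneg (μ := π) (s := B ×ˢ Bᶜ),
    measureReal_nonneg (μ := π) (s := Bᶜ ×ˢ B)]

lemma IsCoupling.abs_sub_eq {π : Measure (X × X)} {μ ν : Measure X} (h : IsCoupling π μ ν)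
    {B : Set X} (hB : MeasurableSet B) (h0 : π (B ×ˢ Bᶜ) = 0 ∨ π (Bᶜ ×ˢ B) = 0) :
    |μ.real B - ν.real B| = π.real (separatedPairs B) := by
  have := h.1
  rw [h.sub_eq hB, measureReal_separatedPairs π hB]
  rcases h0 with h0 | h0
  · simp [measureReal_def, h0]
  · simp [measureReal_def, h0]

variable [TopologicalSpace X] [CompactSpace X] [SecondCountableTopology X] [BorelSpace X]
  {ρ : X → X → ℝ}

/-- Integrating a cut decomposition of the cost against a measure on pairs. -/
lemma IsUltraCost.hasSum_integral (hρ : IsUltraCost ρ) {B : ℕ → Set X} {w : ℕ → ℝ≥0}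
    (hB : ∀ n, IsClopen (B n))
    (hsum : ∀ x y, ∑' n, (w n : ℝ≥0∞) *
      (separatedPairs (B n)).indicator (1 : X × X → ℝ≥0∞) (x, y) = ENNReal.ofReal (ρ x y))
    (π : Measure (X × X)) [IsFiniteMeasure π] :
    HasSum (fun n => (w n : ℝ) * π.real (separatedPairs (B n))) (∫ z, ρ z.1 z.2 ∂π) := by
  have hm : ∀ n, MeasurableSet (separatedPairs (B n)) := fun n =>
    measurableSet_separatedPairs (hB n).isOpen.measurableSet
  have hintg : Integrable (fun z : X × X => ρ z.1 z.2) π :=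
    integrable_of_continuous_of_compactSpace π hρ.continuous
  have h : ∑' n, (w n : ℝ≥0∞) * π (separatedPairs (B n)) = ∫⁻ z, ENNReal.ofReal (ρ z.1 z.2) ∂π := by
    simp_rw [← hsum]
    rw [lintegral_tsum fun n => ((measurable_one.indicator (hm n)).const_mul _).aemeasurable]
    refine tsum_congr fun n => ?_
    rw [lintegral_const_mul _ (measurable_one.indicator (hm n)), lintegral_indicator_one (hm n)]
  have hfin : ∫⁻ z, ENNReal.ofReal (ρ z.1 z.2) ∂π ≠ ∞ := hintg.lintegral_lt_top.ne
  have hs := ENNReal.hasSum_toReal (h ▸ hfin)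
  rw [integral_eq_lintegral_of_nonneg_ae (ae_of_all _ fun z => hρ.nonneg _ _)
    hintg.aestronglyMeasurable, ← h]
  simpa [measureReal_def, ENNReal.tsum_toReal_eq (ENNReal.ne_top_of_tsum_ne_top (h ▸ hfin))]
    using hs

/-- An optimal coupling does not transport mass both into and out of a ball. -/
lemma IsUltraCost.measure_prod_compl_eq_zero_or (hρ : IsUltraCost ρ) {π : Measure (X × X)}
    {μ ν : Measure X} (hπ : IsCoupling π μ ν)
    (hmin : ∀ π', IsCoupling π' μ ν → ∫ z, ρ z.1 z.2 ∂π ≤ ∫ z, ρ z.1 z.2 ∂π')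
    {B : Set X} (hB : MeasurableSet B)
    (hball : ∀ a ∈ B, ∀ b ∈ B, ∀ c ∉ B, ρ a b < ρ a c) :
    π (B ×ˢ Bᶜ) = 0 ∨ π (Bᶜ ×ˢ B) = 0 := by
  by_contra! hne
  have := hπ.1
  have hA : MeasurableSet (B ×ˢ Bᶜ) := hB.prod hB.compl
  have hA' : MeasurableSet (Bᶜ ×ˢ B) := hB.compl.prod hB
  set Γ : Measure ((X × X) × (X × X)) :=
    (π.restrict (B ×ˢ Bᶜ)).prod (π.restrict (Bᶜ ×ˢ B)) with hΓ
  let s₁ : (X × X) × (X × X) → X × X := fun q => (q.1.1, q.2.2)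
  let s₂ : (X × X) × (X × X) → X × X := fun q => (q.2.1, q.1.2)
  have hs₁ : Measurable s₁ := by fun_prop
  have hs₂ : Measurable s₂ := by fun_prop
  have hle : Γ.map Prod.fst + Γ.map Prod.snd ≤ π := by
    have hsmul : ∀ (c : ℝ≥0∞) (m : Measure (X × X)), c ≤ 1 → c • m ≤ m := fun c m hc s => by
      simpa using mul_le_mul_left hc (m s)
    rw [hΓ, Measure.map_fst_prod, Measure.map_snd_prod]
    calc _ ≤ π.restrict (B ×ˢ Bᶜ) + π.restrict (Bᶜ ×ˢ B) :=
          add_le_add (hsmul _ _ (by simpa using prob_le_one))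
            (hsmul _ _ (by simpa using prob_le_one))
      _ = π.restrict (B ×ˢ Bᶜ ∪ Bᶜ ×ˢ B) :=
          (Measure.restrict_union (Set.disjoint_prod.2 (Or.inl disjoint_compl_right)) hA').symm
      _ ≤ π := Measure.restrict_le_self
  obtain ⟨π₀, hπ₀, _⟩ : ∃ π₀ : Measure (X × X),
      π₀ + (Γ.map Prod.fst + Γ.map Prod.snd) = π ∧ IsFiniteMeasure π₀ :=
    ⟨_, Measure.sub_add_cancel_of_le hle, inferInstance⟩
  have hcoup : IsCoupling (π₀ + (Γ.map s₁ + Γ.map s₂)) μ ν := by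
    have h1 : (π₀ + (Γ.map s₁ + Γ.map s₂)).map Prod.fst = μ := by
      rw [← hπ.2.1, ← hπ₀]
      simp only [Measure.map_add _ _ measurable_fst]
      rw [Measure.map_map measurable_fst hs₁, Measure.map_map measurable_fst hs₂,
        Measure.map_map measurable_fst measurable_fst, Measure.map_map measurable_fst measurable_snd]
      rfl
    have h2 : (π₀ + (Γ.map s₁ + Γ.map s₂)).map Prod.snd = ν := by
      rw [← hπ.2.2, ← hπ₀]
      simp only [Measure.map_add _ _ measurable_snd]
      rw [Measure.map_map measurable_snd hs₁, Measure.map_map measurable_snd hs₂,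
        Measure.map_map measurable_snd measurable_fst, Measure.map_map measurable_snd measurable_snd,
        add_comm (Γ.map (Prod.snd ∘ s₁))]
      rfl
    refine ⟨⟨?_⟩, h1, h2⟩
    have hμ : μ Set.univ = 1 := by
      rw [← hπ.2.1, Measure.map_apply measurable_fst .univ]; simp
    rw [← hμ, ← h1, Measure.map_apply measurable_fst .univ, Set.preimage_univ]
  have hintg : ∀ {f : X × X → ℝ} (m : Measure (X × X)) [IsFiniteMeasure m], Continuous f →
      Integrable f m := fun m _ hf => integrable_of_continuous_of_compactSpace m hf
  have hc := hρ.continuous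
  have hmap : ∀ {g : (X × X) × (X × X) → X × X}, Measurable g →
      ∫ z, ρ z.1 z.2 ∂(Γ.map g) = ∫ q, ρ (g q).1 (g q).2 ∂Γ := fun hg =>
    integral_map hg.aemeasurable hc.aestronglyMeasurable
  have hcost := hmin _ hcoup
  rw [← hπ₀, integral_add_measure (hintg _ hc) (hintg _ hc),
    integral_add_measure (hintg _ hc) (hintg _ hc), integral_add_measure (hintg _ hc) (hintg _ hc),
    integral_add_measure (hintg _ hc) (hintg _ hc), hmap hs₁, hmap hs₂, hmap measurable_fst,
    hmap measurable_snd] at hcost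
  have hI : ∀ {g : (X × X) × (X × X) → X × X}, Continuous g →
      Integrable (fun q => ρ (g q).1 (g q).2) Γ := fun hg =>
    integrable_of_continuous_of_compactSpace Γ (hc.comp hg)
  have i₁ := hI (g := s₁) (by fun_prop)
  have i₂ := hI (g := s₂) (by fun_prop)
  have i₃ := hI continuous_fst
  have i₄ := hI continuous_snd
  have hpos : ∀ᵐ q ∂Γ, 0 < (ρ q.1.1 q.1.2 + ρ q.2.1 q.2.2) -
      (ρ (s₁ q).1 (s₁ q).2 + ρ (s₂ q).1 (s₂ q).2) := by
    rw [hΓ, Measure.prod_restrict]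
    filter_upwards [ae_restrict_mem (hA.prod hA')] with q hq
    obtain ⟨⟨a, b⟩, ⟨c, d⟩⟩ := q
    obtain ⟨⟨ha, hb⟩, ⟨hc, hd⟩⟩ := hq
    simp only [s₁, s₂] at *
    have e1 : ρ a d < ρ a b := hball a ha d hd b hb
    have e2 : ρ d a < ρ d c := hball d hd a ha c hc
    have e3 : ρ d b ≤ ρ a b := by
      refine (hρ.ultra d a b).trans (max_le ?_ le_rfl)
      rw [hρ.symm]; exact e1.le
    have e4 := hρ.ultra c d b
    rw [hρ.symm d a, hρ.symm d c] at e2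
    rcases le_max_iff.1 e4 with h | h <;> linarith
  have hΓ0 : Γ ≠ 0 := by
    intro h0
    have : Γ Set.univ = 0 := by simp [h0]
    rw [hΓ, ← Set.univ_prod_univ, Measure.prod_prod] at this
    simp [hne.1, hne.2] at this
  have hlt : 0 < ∫ q, ((ρ q.1.1 q.1.2 + ρ q.2.1 q.2.2) -
      (ρ (s₁ q).1 (s₁ q).2 + ρ (s₂ q).1 (s₂ q).2)) ∂Γ := by
    rw [integral_pos_iff_support_of_nonneg_ae (hpos.mono fun _ h => h.le)
      ((i₃.add i₄).sub (i₁.add i₂)), pos_iff_ne_zero]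
    intro h0
    refine hΓ0 (Measure.measure_univ_eq_zero.1 ?_)
    have h1 := measure_eq_zero_iff_ae_notMem.1 h0
    have : ∀ᵐ q ∂Γ, False := by
      filter_upwards [h1, hpos] with q hq hq'
      exact hq hq'.ne'
    simpa [ae_iff] using this
  have hsub := integral_sub (i₃.add i₄) (i₁.add i₂)
  simp only [Pi.add_apply] at hsub
  rw [hsub, integral_add i₃ i₄, integral_add i₁ i₂] at hlt
  linarith

end Coupling

/-- On a compact metric space, a continuous cost admits an optimal coupling. -/
lemma exists_optimal_coupling {X : Type*} [MetricSpace X] [CompactSpace X] [MeasurableSpace X]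
    [BorelSpace X] {c : X × X → ℝ} (hc : Continuous c) (μ ν : ProbabilityMeasure X) :
    ∃ π, IsCoupling π (μ : Measure X) ν ∧
      ∀ π', IsCoupling π' (μ : Measure X) ν → ∫ z, c z ∂π ≤ ∫ z, c z ∂π' := by
  have : SecondCountableTopology X := UniformSpace.secondCountable_of_separable X
  let K : Set (ProbabilityMeasure (X × X)) :=
    {π | π.map measurable_fst.aemeasurable = μ ∧ π.map measurable_snd.aemeasurable = ν}
  have hK : IsClosed K :=
    (isClosed_eq (ProbabilityMeasure.continuous_map continuous_fst) continuous_const).inter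
      (isClosed_eq (ProbabilityMeasure.continuous_map continuous_snd) continuous_const)
  have hmem : ∀ π : ProbabilityMeasure (X × X), π ∈ K ↔ IsCoupling (π : Measure (X × X)) μ ν :=
    fun π => ⟨fun h => ⟨inferInstance, congrArg Subtype.val h.1, congrArg Subtype.val h.2⟩,
      fun h => ⟨Subtype.ext h.2.1, Subtype.ext h.2.2⟩⟩
  have hne : K.Nonempty := ⟨⟨(μ : Measure X).prod ν, inferInstance⟩,
    (hmem _).2 (isCoupling_prod _ _)⟩
  obtain ⟨π, hπ, hmin⟩ := hK.isCompact.exists_isMinOn hne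
    (ProbabilityMeasure.continuous_integral_continuousMap (⟨c, hc⟩ : C(X × X, ℝ))).continuousOn
  refine ⟨π, (hmem π).1 hπ, fun π' hπ' => ?_⟩
  have := hπ'.1
  exact hmin ((hmem ⟨π', hπ'.1⟩).2 hπ')

lemma isUltraCost_dist_rpow {X : Type*} [MetricSpace X]
    (hX : ∀ x y z : X, dist x z ≤ max (dist x y) (dist y z)) {p : ℝ} (hp : 0 < p) :
    IsUltraCost fun x y : X => dist x y ^ p where
  continuous := (continuous_dist).rpow_const fun _ => Or.inr hp.le
  self x := by simp [Real.zero_rpow hp.ne']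
  symm x y := by rw [dist_comm]
  ultra x y z := by
    rcases le_max_iff.1 (hX x y z) with h | h
    · exact le_max_of_le_left (Real.rpow_le_rpow dist_nonneg h hp.le)
    · exact le_max_of_le_right (Real.rpow_le_rpow dist_nonneg h hp.le)

/-- The `p`-th power of `Wp` is a weighted `ℓ¹` distance between the masses of the balls. -/
lemma hasSum_Wp_rpow {X : Type*} [MetricSpace X] [CompactSpace X] [MeasurableSpace X]
    [BorelSpace X] {p : ℝ} (hp : 0 < p) (hρ : IsUltraCost fun x y : X => dist x y ^ p)
    {B : ℕ → Set X} {w : ℕ → ℝ≥0} (hB : ∀ n, IsClopen (B n))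
    (hball : ∀ n, w n ≠ 0 → ∀ a ∈ B n, ∀ b ∈ B n, ∀ c ∉ B n, dist a b ^ p < dist a c ^ p)
    (hsum : ∀ x y, ∑' n, (w n : ℝ≥0∞) *
      (separatedPairs (B n)).indicator (1 : X × X → ℝ≥0∞) (x, y) = ENNReal.ofReal (dist x y ^ p))
    (μ ν : ProbabilityMeasure X) :
    HasSum (fun n => (w n : ℝ) * |(μ : Measure X).real (B n) - (ν : Measure X).real (B n)|)
      (Wp p (μ : Measure X) (ν : Measure X) ^ p) := by
  have : SecondCountableTopology X := UniformSpace.secondCountable_of_separable X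
  obtain ⟨π, hπ, hmin⟩ := exists_optimal_coupling hρ.continuous μ ν
  have := hπ.1
  have hleast : IsLeast {c : ℝ | ∃ π : Measure (X × X), IsCoupling π (μ : Measure X) ν ∧
      c = ∫ ab, dist ab.1 ab.2 ^ p ∂π} (∫ ab, dist ab.1 ab.2 ^ p ∂π) :=
    ⟨⟨π, hπ, rfl⟩, by rintro _ ⟨π', hπ', rfl⟩; exact hmin π' hπ'⟩
  rw [Wp, hleast.csInf_eq, ← Real.rpow_mul (integral_nonneg fun z => hρ.nonneg _ _),
    one_div_mul_cancel hp.ne', Real.rpow_one]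
  convert hρ.hasSum_integral hB hsum π using 2 with n
  rcases eq_or_ne (w n) 0 with h0 | h0
  · simp [h0]
  · rw [hπ.abs_sub_eq (hB n).isOpen.measurableSet
      (hρ.measure_prod_compl_eq_zero_or hπ hmin (hB n).isOpen.measurableSet (hball n h0))]

/-- Theorem 1.1: for a compact ultrametric space `X`, the space of Borel probability
measures endowed with `W_p^p` is affinely isometric to a convex subset of `ℓ¹`. -/
theorem wasserstein_ultrametric_embeds_in_ell1
    {X : Type*} [MetricSpace X] [CompactSpace X] [MeasurableSpace X] [BorelSpace X]
    (hX : ∀ x y z : X, dist x z ≤ max (dist x y) (dist y z))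
    (p : ℝ) (hp : 1 ≤ p) :
    ∃ φ : ProbabilityMeasure X → lp (fun _ : ℕ => ℝ) 1,
      (∀ (μ ν σ : ProbabilityMeasure X) (t : ℝ≥0), t ≤ 1 →
        (σ : Measure X) = (1 - t) • (μ : Measure X) + t • (ν : Measure X) →
        φ σ = ((1 - t : ℝ≥0) : ℝ) • φ μ + ((t : ℝ≥0) : ℝ) • φ ν) ∧
      (∀ μ ν : ProbabilityMeasure X,
        ‖φ μ - φ ν‖ = Wp p (μ : Measure X) (ν : Measure X) ^ p) ∧
      Convex ℝ (Set.range φ) := by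
  have hp0 : 0 < p := zero_lt_one.trans_le hp
  have : SecondCountableTopology X := UniformSpace.secondCountable_of_separable X
  have : IsUltrametricDist X := ⟨hX⟩
  have : Countable (TopologicalSpace.Clopens X) :=
    TopologicalSpace.Clopens.countable_iff_secondCountable.2 inferInstance
  have hρ := isUltraCost_dist_rpow hX hp0
  obtain ⟨B, w, hB, hball, hsum⟩ := hρ.exists_cut_decomposition
  have hW := hasSum_Wp_rpow hp0 hρ hB hball hsum
  rcases isEmpty_or_nonempty (ProbabilityMeasure X) with hE | ⟨⟨μ₀⟩⟩
  · exact ⟨fun μ => hE.elim μ, fun μ => hE.elim μ, fun μ => hE.elim μ,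
      by rw [Set.range_eq_empty]; exact convex_empty⟩
  let f : ProbabilityMeasure X → ℕ → ℝ := fun μ n =>
    w n * ((μ : Measure X).real (B n) - (μ₀ : Measure X).real (B n))
  have hf : ∀ μ, Memℓp (f μ) 1 := fun μ => by
    refine memℓp_gen ?_
    simpa [f, abs_mul] using (hW μ μ₀).summable
  have haff : ∀ (μ ν σ : ProbabilityMeasure X) (t : ℝ≥0), t ≤ 1 →
      (σ : Measure X) = (1 - t) • (μ : Measure X) + t • (ν : Measure X) →
      (⟨f σ, hf σ⟩ : lp (fun _ : ℕ => ℝ) 1) =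
        ((1 - t : ℝ≥0) : ℝ) • ⟨f μ, hf μ⟩ + ((t : ℝ≥0) : ℝ) • ⟨f ν, hf ν⟩ := by
    intro μ ν σ t ht hσ
    ext n
    change f σ n = ((1 - t : ℝ≥0) : ℝ) * f μ n + (t : ℝ) * f ν n
    have hreal : (σ : Measure X).real (B n) =
        ((1 - t : ℝ≥0) : ℝ) * (μ : Measure X).real (B n) + t * (ν : Measure X).real (B n) := by
      rw [hσ, measureReal_add_apply, measureReal_nnreal_smul_apply, measureReal_nnreal_smul_apply]
    simp only [f, hreal, NNReal.coe_sub ht, NNReal.coe_one]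
    ring
  refine ⟨fun μ => ⟨f μ, hf μ⟩, haff, fun μ ν => ?_, ?_⟩
  · rw [lp.norm_eq_tsum_rpow (by simp), ← (hW μ ν).tsum_eq]
    simp only [ENNReal.toReal_one, Real.rpow_one, one_div_one]
    refine tsum_congr fun n => ?_
    change |f μ n - f ν n| = _
    rw [← mul_sub, sub_sub_sub_cancel_right, abs_mul, abs_of_nonneg (w n).coe_nonneg]
  · rintro _ ⟨μ, rfl⟩ _ ⟨ν, rfl⟩ a b ha hb hab
    lift b to ℝ≥0 using hb
    have hb1 : b ≤ 1 := by
      rw [← NNReal.coe_le_coe, NNReal.coe_one]; linarith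
    have ha' : a = ((1 - b : ℝ≥0) : ℝ) := by
      rw [NNReal.coe_sub hb1, NNReal.coe_one]; linarith
    subst ha'
    have hprob : IsProbabilityMeasure ((1 - b) • (μ : Measure X) + b • (ν : Measure X)) := by
      refine ⟨?_⟩
      simp only [Measure.add_apply, Measure.smul_apply, measure_univ, ENNReal.smul_def, smul_eq_mul,
        mul_one]
      rw [← ENNReal.coe_add, tsub_add_cancel_of_le hb1, ENNReal.coe_one]
    exact ⟨⟨_, hprob⟩, haff μ ν ⟨_, hprob⟩ b hb1 rfl⟩
end

section
/- Let α > 1. Then the power-exponential critical parameter of the Banach cube satisfies crit_P(BC((n^{−α})_{n≥1})) = 1/(α − 1). -/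
open MeasureTheory
open scoped ENNReal NNReal

/-- The gauge `r ↦ exp(-r^{-s})` used to define the power-exponential critical parameter. -/
noncomputable def expGauge (s : ℝ) (r : ℝ≥0∞) : ℝ≥0∞ :=
  if r = 0 then 0 else ENNReal.ofReal (Real.exp (-r.toReal ^ (-s)))

/-- The generalized Hausdorff ("mkMetric") outer measure with gauge `r ↦ exp (-r^{-s})`,
evaluated on the whole space. -/
noncomputable def genHausdorff (Z : Type*) [EMetricSpace Z] (s : ℝ) : ℝ≥0∞ :=
  (MeasureTheory.OuterMeasure.mkMetric (expGauge s) : MeasureTheory.OuterMeasure Z) Set.univ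

/-- The power-exponential critical parameter `crit_𝒫`. -/
noncomputable def critP (Z : Type*) [EMetricSpace Z] : ℝ≥0∞ :=
  sSup (ENNReal.ofReal '' {s : ℝ | 0 < s ∧ genHausdorff Z s = ∞})

/-- The Banach cube `BC((a_n)) = {x ∈ ℓ¹ | 0 ≤ x_n ≤ a_n}`. -/
def BCube (a : ℕ → ℝ) : Set (lp (fun _ : ℕ => ℝ) 1) :=
  {x | ∀ n : ℕ, 0 ≤ x n ∧ x n ≤ a n}

theorem lp_one_edist_eq (x y : lp (fun _ : ℕ => ℝ) 1) :
    edist x y = ENNReal.ofReal (∑' i, |x i - y i|) := by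
  rw [edist_dist, dist_eq_norm, lp.norm_eq_tsum_rpow (by simp)]
  simp

theorem lp_one_summable_abs_sub (x y : lp (fun _ : ℕ => ℝ) 1) :
    Summable fun i => |x i - y i| := by
  have h := (memℓp_gen_iff (p := 1) (by simp)).1 (x - y).2
  simpa using h

theorem sum_abs_sub_le_of_edist_le {x y : lp (fun _ : ℕ => ℝ) 1} {r : ℝ≥0}
    (h : edist x y ≤ r) (s : Finset ℕ) : ∑ i ∈ s, |x i - y i| ≤ r := by
  rw [lp_one_edist_eq, ENNReal.ofReal_le_iff_le_toReal ENNReal.coe_ne_top] at h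
  exact ((lp_one_summable_abs_sub x y).sum_le_tsum s fun _ _ => abs_nonneg _).trans
    (by simpa using h)

/-- The normalized Lebesgue measure on `[0, a]`. -/
noncomputable def intervalProb (a : ℝ) : Measure ℝ :=
  (ENNReal.ofReal a)⁻¹ • volume.restrict (Set.Icc 0 a)

theorem isProbabilityMeasure_intervalProb {a : ℝ} (ha : 0 < a) :
    IsProbabilityMeasure (intervalProb a) := by
  constructor
  simp only [intervalProb, Measure.smul_apply, Measure.restrict_apply_univ, Real.volume_Icc,
    sub_zero, smul_eq_mul]
  exact ENNReal.inv_mul_cancel (by simpa using ha) ENNReal.ofReal_ne_top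

theorem pi_intervalProb_le {ι : Type*} [Fintype ι] {a : ι → ℝ} (ha : ∀ i, 0 < a i)
    (S : Set (ι → ℝ)) :
    Measure.pi (fun i => intervalProb (a i)) S ≤ (∏ i, ENNReal.ofReal (a i))⁻¹ * volume S := by
  have := fun i => isProbabilityMeasure_intervalProb (ha i)
  have h : Measure.pi (fun i => intervalProb (a i)) =
      (∏ i, ENNReal.ofReal (a i))⁻¹ • volume.restrict (Set.univ.pi fun i => Set.Icc 0 (a i)) := by
    refine Measure.pi_eq fun s hs => ?_
    rw [volume_pi, Measure.restrict_pi_pi, Measure.smul_apply, Measure.pi_pi,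
      ENNReal.prod_inv_distrib (by simp [Set.Pairwise]), smul_eq_mul, ← Finset.prod_mul_distrib]
    rfl
  rw [h, Measure.smul_apply, smul_eq_mul]
  gcongr
  exact Measure.restrict_le_self

theorem volume_l1_closedBall {ι : Type*} [Fintype ι] [Nonempty ι] (y : ι → ℝ) (r : ℝ≥0) :
    volume {x : ι → ℝ | ∑ i, |x i - y i| ≤ r} =
      ENNReal.ofReal ((2 * r) ^ Fintype.card ι / (Fintype.card ι).factorial) := by
  have h := volume_sum_rpow_le ι (le_refl (1 : ℝ)) r
  have e : {x : ι → ℝ | ∑ i, |x i - y i| ≤ r} =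
      (fun x => x + -y) ⁻¹' {x : ι → ℝ | (∑ i, |x i| ^ (1 : ℝ)) ^ (1 / (1 : ℝ)) ≤ r} := by
    ext x; simp [← sub_eq_add_neg]
  rw [e, measure_preimage_add_right, h, ← ENNReal.ofReal_pow r.coe_nonneg,
    ← ENNReal.ofReal_mul (by positivity)]
  have : Real.Gamma 2 = 1 := by simp
  congr 1
  rw [show (1 / (1 : ℝ) + 1) = 2 by norm_num, this, div_one, Real.Gamma_nat_eq_factorial, mul_pow]
  simp; ring

theorem exists_outerMeasure_bcube {a : ℕ → ℝ} (ha : ∀ n, 0 < a n) (hs : Summable a) :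
    ∃ m : OuterMeasure (BCube a), m Set.univ = 1 ∧
      ∀ N : ℕ, N ≠ 0 → ∀ (r : ℝ≥0) (S : Set (BCube a)), Metric.ediam S ≤ r →
        m S ≤ ENNReal.ofReal ((2 * r) ^ N / N.factorial / ∏ i ∈ Finset.range N, a i) := by
  have := fun i => isProbabilityMeasure_intervalProb (ha i)
  let P := Measure.infinitePi fun i => intervalProb (a i)
  let f : BCube a → ℕ → ℝ := fun x => x.1
  refine ⟨OuterMeasure.comap f P.toOuterMeasure, ?_, ?_⟩
  · have hr : f '' Set.univ = Set.univ.pi fun i => Set.Icc 0 (a i) := by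
      ext x
      simp only [Set.image_univ, Set.mem_range, Set.mem_pi, Set.mem_univ, forall_const, Set.mem_Icc]
      constructor
      · rintro ⟨y, rfl⟩
        exact y.2
      · intro hx
        refine ⟨⟨⟨x, memℓp_gen ?_⟩, hx⟩, rfl⟩
        simp only [ENNReal.toReal_one, Real.rpow_one, Real.norm_eq_abs]
        exact hs.of_nonneg_of_le (fun _ => abs_nonneg _) fun i => by
          rw [abs_of_nonneg (hx i).1]; exact (hx i).2
    have h1 : ∀ i, intervalProb (a i) (Set.Icc 0 (a i)) = 1 := fun i => by
      simp only [intervalProb, Measure.smul_apply, Measure.restrict_apply_self, Real.volume_Icc,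
        sub_zero, smul_eq_mul]
      exact ENNReal.inv_mul_cancel (by simpa using ha i) ENNReal.ofReal_ne_top
    rw [OuterMeasure.comap_apply, hr]
    change P _ = 1
    simp only [P]
    rw [Measure.infinitePi_pi_univ _ fun i => measurableSet_Icc]
    simp [h1]
  · intro N hN r S hS
    obtain rfl | ⟨y, hy⟩ := S.eq_empty_or_nonempty
    · simp
    have hne : Nonempty (Finset.range N) := ⟨⟨0, by simpa using Nat.pos_of_ne_zero hN⟩⟩
    let B : Set (Finset.range N → ℝ) := {x | ∑ i, |x i - y.1 i| ≤ r}
    have hB : MeasurableSet B := measurableSet_le (by fun_prop) (by fun_prop)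
    rw [OuterMeasure.comap_apply]
    calc P (f '' S) ≤ P (cylinder (Finset.range N) B) := by
          refine measure_mono ?_
          rintro _ ⟨x, hx, rfl⟩
          have hxy : edist x.1 y.1 ≤ r := (Metric.edist_le_ediam_of_mem hx hy).trans hS
          have := sum_abs_sub_le_of_edist_le hxy (Finset.range N)
          rw [← Finset.sum_coe_sort] at this
          exact this
      _ ≤ _ := by
          simp only [P]
          rw [Measure.infinitePi_cylinder _ hB]
          refine (pi_intervalProb_le (a := fun i : Finset.range N => a i)
            (fun i => ha i) B).trans ?_
          rw [volume_l1_closedBall, Fintype.card_coe, Finset.card_range,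
            ENNReal.ofReal_div_of_pos (Finset.prod_pos fun i _ => ha i), ENNReal.div_eq_inv_mul,
            ENNReal.ofReal_prod_of_nonneg fun i _ => (ha i).le,
            Finset.prod_coe_sort (Finset.range N) fun i => ENNReal.ofReal (a i)]

theorem eventually_add_rpow_le_mul_rpow {s p c : ℝ} (hs : 0 < s) (hsp : s < p) (hc : 0 < c)
    (K : ℝ) : ∀ᶠ u : ℝ in Filter.atTop, K + u ^ s ≤ c * u ^ p := by
  have h1 : Filter.Tendsto (fun u : ℝ => c * u ^ (p - s) + -1) Filter.atTop Filter.atTop :=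
    Filter.tendsto_atTop_add_const_right _ _
      ((tendsto_rpow_atTop (sub_pos.2 hsp)).const_mul_atTop hc)
  have h2 := (tendsto_rpow_atTop hs).atTop_mul_atTop₀ h1
  filter_upwards [h2.eventually_ge_atTop K, Filter.eventually_gt_atTop 0] with u hu hu0
  have : u ^ p = u ^ s * u ^ (p - s) := by rw [← Real.rpow_add hu0]; ring_nf
  rw [this]
  linarith

theorem prod_range_add_one_rpow (N : ℕ) (β : ℝ) :
    ∏ i ∈ Finset.range N, ((i : ℝ) + 1) ^ β = (N.factorial : ℝ) ^ β := by
  rw [Real.finsetProd_rpow _ _ fun i _ => by positivity, ← Finset.prod_range_add_one_eq_factorial]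
  push_cast
  rfl

theorem exists_volume_bound_le_exp {α s K : ℝ} (hα : 1 < α) (hs : 0 < s) (hsα : s < 1 / (α - 1)) :
    ∃ r₀ > 0, ∀ r : ℝ, 0 < r → r ≤ r₀ → ∃ N : ℕ, N ≠ 0 ∧
      Real.exp K * ((2 * r) ^ N / N.factorial / ∏ i ∈ Finset.range N, ((i : ℝ) + 1) ^ (-α)) ≤
        Real.exp (-r ^ (-s)) := by
  have hα' : 0 < α - 1 := by linarith
  set p := 1 / (α - 1) with hp
  have hp0 : 0 < p := by positivity
  set c : ℝ := (2 * Real.exp 1) ^ (-p) with hc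
  have hc0 : 0 < c := by positivity
  obtain ⟨U, hU⟩ := Filter.eventually_atTop.1
    (eventually_add_rpow_le_mul_rpow hs hsα hc0 (|K| + 1))
  refine ⟨(max U 1)⁻¹, by positivity, fun r hr hr₀ => ?_⟩
  have hu : U ≤ r⁻¹ := (le_max_left _ _).trans ((le_inv_comm₀ hr (by positivity)).1 hr₀)
  have key := hU _ hu
  rw [← Real.rpow_neg_eq_inv_rpow, ← Real.rpow_neg_eq_inv_rpow, hc,
    ← Real.mul_rpow (by positivity) hr.le] at key
  set t := (2 * Real.exp 1 * r) ^ (-p) with ht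
  have hrs : 0 < r ^ (-s) := by positivity
  have ht1 : 1 ≤ t := by have := abs_nonneg K; linarith
  have hN0 : 0 < ⌊t⌋₊ := Nat.floor_pos.2 ht1
  have hNt : (⌊t⌋₊ : ℝ) ≤ t := Nat.floor_le (by linarith)
  have hNt' : t < ⌊t⌋₊ + 1 := Nat.lt_floor_add_one t
  set N := ⌊t⌋₊
  refine ⟨N, hN0.ne', ?_⟩
  rw [prod_range_add_one_rpow]
  have hf : (0 : ℝ) < N.factorial := by positivity
  have h1 : (2 * r) ^ N / N.factorial / (N.factorial : ℝ) ^ (-α) =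
      (2 * r) ^ N * (N.factorial : ℝ) ^ (α - 1) := by
    rw [Real.rpow_neg hf.le, Real.rpow_sub hf, Real.rpow_one]
    field_simp
  have h2 : (N.factorial : ℝ) ^ (α - 1) ≤ ((N : ℝ) ^ (α - 1)) ^ N := by
    rw [Real.rpow_pow_comm (by positivity)]
    exact Real.rpow_le_rpow hf.le (mod_cast N.factorial_le_pow) hα'.le
  have h3 : (N : ℝ) ^ (α - 1) ≤ (2 * Real.exp 1 * r)⁻¹ := by
    refine (Real.rpow_le_rpow (by positivity) hNt hα'.le).trans_eq ?_
    rw [ht, ← Real.rpow_mul (by positivity), hp,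
      show -(1 / (α - 1)) * (α - 1) = -1 by field_simp, Real.rpow_neg_one]
  have h4 : 2 * r * (N : ℝ) ^ (α - 1) ≤ Real.exp (-1) := by
    refine (mul_le_mul_of_nonneg_left h3 (by positivity)).trans_eq ?_
    rw [Real.exp_neg]
    field_simp
  calc _ ≤ Real.exp K * (2 * r * (N : ℝ) ^ (α - 1)) ^ N := by
        rw [h1, mul_pow (2 * r)]
        gcongr
    _ ≤ Real.exp K * Real.exp (-1) ^ N := by gcongr
    _ = Real.exp (K - N) := by rw [← Real.exp_nat_mul, ← Real.exp_add]; ring_nf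
    _ ≤ _ := Real.exp_le_exp.2 (by have := le_abs_self K; linarith)

theorem genHausdorff_bcube_eq_top {α s : ℝ} (hα : 1 < α) (hs : 0 < s) (hsα : s < 1 / (α - 1)) :
    genHausdorff (BCube fun n : ℕ => ((n : ℝ) + 1) ^ (-α)) s = ∞ := by
  obtain ⟨m, hm1, hm⟩ := exists_outerMeasure_bcube (a := fun n : ℕ => ((n : ℝ) + 1) ^ (-α))
    (fun n => by positivity)
    (by simpa using (summable_nat_add_iff 1).2 (Real.summable_nat_rpow.2 (by linarith : -α < -1)))
  refine ENNReal.eq_top_of_forall_nnreal_le fun C => ?_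
  obtain ⟨r₀, hr₀, h⟩ := exists_volume_bound_le_exp (K := C) hα hs hsα
  have hle : (C : ℝ≥0∞) • m ≤ OuterMeasure.mkMetric (expGauge s) := by
    refine OuterMeasure.le_mkMetric _ _ (ENNReal.ofReal r₀) (by simpa using hr₀) fun S hS => ?_
    lift Metric.ediam S to ℝ≥0 using ne_top_of_le_ne_top ENNReal.ofReal_ne_top hS with r hr
    rw [smul_apply, smul_eq_mul]
    rcases eq_or_ne r 0 with rfl | hr0
    · have := hm 1 one_ne_zero 0 S hr.ge
      simp only [NNReal.coe_zero, mul_zero, pow_one, zero_div, ENNReal.ofReal_zero,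
        nonpos_iff_eq_zero] at this
      simp [this]
    · obtain ⟨N, hN, hNr⟩ := h r (by positivity)
        (by simpa using (ENNReal.le_ofReal_iff_toReal_le ENNReal.coe_ne_top hr₀.le).1 hS)
      rw [expGauge, if_neg (by simpa using hr0), ENNReal.coe_toReal]
      refine le_trans ?_ (ENNReal.ofReal_le_ofReal hNr)
      rw [ENNReal.ofReal_mul (by positivity)]
      gcongr
      · rw [← ENNReal.ofReal_coe_nnreal]
        exact ENNReal.ofReal_le_ofReal (by linarith [Real.add_one_le_exp (C : ℝ)])
      · exact hm N hN r S hr.ge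
  have := hle Set.univ
  rwa [smul_apply, hm1, smul_eq_mul, mul_one] at this

theorem add_one_rpow_neg_le {α : ℝ} (hα : 1 < α) {n : ℕ} (hn : n ≠ 0) :
    ((n : ℝ) + 1) ^ (-α) ≤
      1 / (α - 1) * ((n : ℝ) ^ (1 - α) - ((n : ℝ) + 1) ^ (1 - α)) := by
  have hα' : 0 < α - 1 := by linarith
  have hn0 : (0 : ℝ) < n := by positivity
  have h1 : 1 + (α - 1) / (n + 1) ≤ ((n : ℝ) / (n + 1)) ^ (1 - α) := by
    have hlog := Real.log_le_sub_one_of_pos (show (0 : ℝ) < n / (n + 1) by positivity)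
    rw [Real.rpow_def_of_pos (by positivity)]
    refine le_trans ?_ (Real.add_one_le_exp _)
    have : (n : ℝ) / (n + 1) - 1 = -(1 / (n + 1)) := by field_simp; ring
    rw [this] at hlog
    have := mul_le_mul_of_nonneg_right hlog hα'.le
    have e : (α - 1) / ((n : ℝ) + 1) = 1 / (n + 1) * (α - 1) := by ring
    rw [e]
    linarith
  rw [Real.div_rpow (by positivity) (by positivity), le_div_iff₀ (by positivity)] at h1
  have h2 : ((n : ℝ) + 1) ^ (1 - α) = ((n : ℝ) + 1) ^ (-α) * (n + 1) := by
    rw [← Real.rpow_add_one (by positivity)]; ring_nf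
  rw [one_div, ← div_eq_inv_mul, le_div_iff₀ hα']
  have h3 : (1 + (α - 1) / ((n : ℝ) + 1)) * (n + 1) ^ (1 - α) =
      (n + 1) ^ (1 - α) + (α - 1) * (n + 1) ^ (-α) := by
    rw [h2]; field_simp
  linarith

theorem sum_range_le_of_le_rpow {α : ℝ} (hα : 1 < α) {N : ℕ} (hN : N ≠ 0) {f : ℕ → ℝ}
    (h₁ : ∀ i < N, f i ≤ (N : ℝ) ^ (-α)) (h₂ : ∀ i, N ≤ i → f i ≤ ((i : ℝ) + 1) ^ (-α)) (M : ℕ) :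
    ∑ i ∈ Finset.range M, f i ≤ (1 + 1 / (α - 1)) * (N : ℝ) ^ (1 - α) := by
  have hα' : 0 < α - 1 := by linarith
  have hN0 : (0 : ℝ) < N := by positivity
  have head : ∀ M ≤ N, ∑ i ∈ Finset.range M, f i ≤ (N : ℝ) ^ (1 - α) := fun M hM => by
    calc _ ≤ ∑ i ∈ Finset.range M, (N : ℝ) ^ (-α) :=
          Finset.sum_le_sum fun i hi => h₁ i ((Finset.mem_range.1 hi).trans_le hM)
      _ = M * (N : ℝ) ^ (-α) := by simp
      _ ≤ N * (N : ℝ) ^ (-α) := by gcongr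
      _ = (N : ℝ) ^ (1 - α) := by
        rw [mul_comm, ← Real.rpow_add_one (by positivity)]; ring_nf
  rcases le_total M N with hM | hM
  · refine (head M hM).trans (le_mul_of_one_le_left (by positivity) ?_)
    have : 0 < 1 / (α - 1) := by positivity
    linarith
  have tail : ∑ i ∈ Finset.range M, f i ≤ (N : ℝ) ^ (1 - α) +
      1 / (α - 1) * ((N : ℝ) ^ (1 - α) - (M : ℝ) ^ (1 - α)) := by
    induction M, hM using Nat.le_induction with
    | base => simpa using head N le_rfl
    | succ n hn ih =>
      rw [Finset.sum_range_succ]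
      have := (h₂ n hn).trans (add_one_rpow_neg_le hα (by lia))
      push_cast
      linarith
  have : 0 ≤ 1 / (α - 1) * (M : ℝ) ^ (1 - α) := by positivity
  linarith

theorem prod_floor_add_one_le {α : ℝ} (hα : 1 < α) (N : ℕ) :
    ((∏ i : Fin N, (⌊((i : ℝ) + 1) ^ (-α) / (N : ℝ) ^ (-α)⌋₊ + 1) : ℕ) : ℝ) ≤
      Real.exp ((1 + α) * N) := by
  have hle : ∀ i : Fin N, ((⌊((i : ℝ) + 1) ^ (-α) / (N : ℝ) ^ (-α)⌋₊ + 1 : ℕ) : ℝ) ≤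
      2 * (((i : ℝ) + 1) ^ (-α) * (N : ℝ) ^ α) := fun i => by
    have hN0 : (0 : ℝ) < N := by have := i.2; exact_mod_cast (by lia : 0 < N)
    have hi : ((i : ℝ) + 1) ≤ N := mod_cast i.2
    rw [Real.rpow_neg hN0.le, div_inv_eq_mul]
    have h1 : 1 ≤ ((i : ℝ) + 1) ^ (-α) * (N : ℝ) ^ α := by
      rw [Real.rpow_neg (by positivity), inv_mul_eq_div, one_le_div (by positivity)]
      exact Real.rpow_le_rpow (by positivity) hi (by linarith)
    have := Nat.floor_le (zero_le_one.trans h1)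
    push_cast
    linarith
  have hf : (0 : ℝ) < N.factorial := by positivity
  calc _ ≤ ∏ i : Fin N, 2 * (((i : ℝ) + 1) ^ (-α) * (N : ℝ) ^ α) := by
        rw [Nat.cast_prod]
        exact Finset.prod_le_prod (fun i _ => by positivity) fun i _ => hle i
    _ = 2 ^ N * ((N : ℝ) ^ N / N.factorial) ^ α := by
        rw [Fin.prod_univ_eq_prod_range (fun i : ℕ => 2 * (((i : ℝ) + 1) ^ (-α) * (N : ℝ) ^ α)),
          Finset.prod_mul_distrib, Finset.prod_mul_distrib, prod_range_add_one_rpow,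
          Real.div_rpow (by positivity) hf.le, Real.rpow_neg hf.le,
          ← Real.rpow_pow_comm (by positivity)]
        simp
        ring
    _ ≤ Real.exp 1 ^ N * Real.exp N ^ α := by
        gcongr
        · linarith [Real.add_one_le_exp 1]
        · exact Real.pow_div_factorial_le_exp _ (by positivity) N
    _ = _ := by
        rw [← Real.exp_nat_mul, ← Real.exp_mul, ← Real.exp_add]; ring_nf

theorem abs_sub_le_of_floor_div_eq {x y h : ℝ} (hx : 0 ≤ x) (hy : 0 ≤ y) (hh : 0 < h)
    (e : ⌊x / h⌋₊ = ⌊y / h⌋₊) : |x - y| ≤ h := by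
  have h1 := Nat.floor_le (div_nonneg hx hh.le)
  have h2 := Nat.floor_le (div_nonneg hy hh.le)
  have h3 := Nat.lt_floor_add_one (x / h)
  have h4 := Nat.lt_floor_add_one (y / h)
  rw [e] at h1 h3
  have : |x / h - y / h| ≤ 1 := abs_le.2 ⟨by linarith, by linarith⟩
  rwa [← sub_div, abs_div, abs_of_pos hh, div_le_one hh] at this

theorem exists_bcube_cover {α : ℝ} (hα : 1 < α) {N : ℕ} (hN : N ≠ 0) :
    ∃ (ι : Type) (_ : Fintype ι) (S : ι → Set (BCube fun n : ℕ => ((n : ℝ) + 1) ^ (-α))),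
      ⋃ i, S i = Set.univ ∧ (Fintype.card ι : ℝ) ≤ Real.exp ((1 + α) * N) ∧
      ∀ i, Metric.ediam (S i) ≤ ENNReal.ofReal ((1 + 1 / (α - 1)) * (N : ℝ) ^ (1 - α)) := by
  have hh : (0 : ℝ) < (N : ℝ) ^ (-α) := by positivity
  refine ⟨(i : Fin N) → Fin (⌊((i : ℝ) + 1) ^ (-α) / (N : ℝ) ^ (-α)⌋₊ + 1), inferInstance,
    fun j => {x | ∀ i : Fin N, ⌊x.1 i / (N : ℝ) ^ (-α)⌋₊ = j i}, ?_, ?_, fun j => ?_⟩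
  · refine Set.eq_univ_of_forall fun x => Set.mem_iUnion.2
      ⟨fun i => ⟨⌊x.1 i / (N : ℝ) ^ (-α)⌋₊, Nat.lt_succ_of_le (Nat.floor_mono ?_)⟩, fun i => rfl⟩
    exact div_le_div_of_nonneg_right (x.2 i).2 hh.le
  · simpa using prod_floor_add_one_le hα N
  · refine Metric.ediam_le fun x hx y hy => ?_
    rw [Subtype.edist_eq, lp_one_edist_eq]
    refine ENNReal.ofReal_le_ofReal (Real.tsum_le_of_sum_range_le (fun _ => abs_nonneg _)
      (sum_range_le_of_le_rpow hα hN (fun i hi => ?_) fun i _ => ?_))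
    · exact abs_sub_le_of_floor_div_eq (x.2 i).1 (y.2 i).1 hh
        ((hx ⟨i, hi⟩).trans (hy ⟨i, hi⟩).symm)
    · have hx := x.2 i
      have hy := y.2 i
      exact abs_le.2 ⟨by linarith, by linarith⟩

theorem expGauge_le {s D : ℝ} (hs : 0 ≤ s) (hD : 0 ≤ D) {r : ℝ≥0∞} (h : r ≤ ENNReal.ofReal D) :
    expGauge s r ≤ ENNReal.ofReal (Real.exp (-D ^ (-s))) := by
  unfold expGauge
  split_ifs with hr
  · exact zero_le
  · have hr' : 0 < r.toReal := ENNReal.toReal_pos hr (ne_top_of_le_ne_top ENNReal.ofReal_ne_top h)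
    have := Real.rpow_le_rpow_of_nonpos hr' (ENNReal.toReal_le_of_le_ofReal hD h) (neg_nonpos.2 hs)
    gcongr

theorem genHausdorff_bcube_le_one {α s : ℝ} (hα : 1 < α) (hsα : 1 / (α - 1) < s) :
    genHausdorff (BCube fun n : ℕ => ((n : ℝ) + 1) ^ (-α)) s ≤ 1 := by
  have hα' : 0 < α - 1 := by linarith
  have hs : 0 < s := lt_trans (by positivity) hsα
  set B := 1 + 1 / (α - 1) with hB
  have hB0 : 0 < B := by positivity
  have hq : 1 < (α - 1) * s := by rwa [div_lt_iff₀' hα'] at hsα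
  unfold genHausdorff OuterMeasure.mkMetric OuterMeasure.mkMetric'
  simp only [OuterMeasure.iSup_apply]
  refine iSup₂_le fun r hr => ?_
  have hD : Filter.Tendsto (fun N : ℕ => ENNReal.ofReal (B * (N : ℝ) ^ (1 - α)))
      Filter.atTop (nhds 0) := by
    have h := ((tendsto_rpow_neg_atTop hα').comp tendsto_natCast_atTop_atTop).const_mul B
    simpa using ENNReal.tendsto_ofReal h
  have hc : 0 < (1 + α)⁻¹ * B ^ (-s) := by positivity
  have hev := tendsto_natCast_atTop_atTop.eventually
    (eventually_add_rpow_le_mul_rpow one_pos hq hc 0)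
  obtain ⟨N, hNr, hN, hN0⟩ := ((hD.eventually_le_const hr).and
    (hev.and (Filter.eventually_ne_atTop 0))).exists
  obtain ⟨ι, _, S, hS, hcard, hdiam⟩ := exists_bcube_cover hα hN0
  have hexp : (1 + α) * N ≤ (B * (N : ℝ) ^ (1 - α)) ^ (-s) := by
    rw [Real.mul_rpow hB0.le (by positivity), ← Real.rpow_mul (by positivity),
      show (1 - α) * -s = (α - 1) * s by ring]
    rwa [zero_add, Real.rpow_one, mul_assoc, le_inv_mul_iff₀ (by linarith)] at hN
  rw [← hS]
  calc _ ≤ ∑ i, OuterMeasure.mkMetric'.pre (fun s' => expGauge s (Metric.ediam s')) r (S i) :=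
        measure_iUnion_fintype_le _ _
    _ ≤ ∑ _i : ι, ENNReal.ofReal (Real.exp (-(B * (N : ℝ) ^ (1 - α)) ^ (-s))) :=
        Finset.sum_le_sum fun i _ =>
          (OuterMeasure.mkMetric'.pre_le ((hdiam i).trans hNr)).trans
            (expGauge_le hs.le (by positivity) (hdiam i))
    _ = ENNReal.ofReal (Fintype.card ι * Real.exp (-(B * (N : ℝ) ^ (1 - α)) ^ (-s))) := by
        rw [ENNReal.ofReal_mul (by positivity)]; simp
    _ ≤ 1 := by
        rw [ENNReal.ofReal_le_one]
        refine (mul_le_mul_of_nonneg_right hcard (Real.exp_pos _).le).trans ?_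
        rw [← Real.exp_add, Real.exp_le_one_iff]
        linarith

/-- Equation (1): the critical parameter of the Banach cube `BC((n^{-α}))` is `1/(α-1)`. -/
theorem critP_banach_cube (α : ℝ) (hα : 1 < α) :
    critP (BCube fun n : ℕ => ((n : ℝ) + 1) ^ (-α)) = ENNReal.ofReal (1 / (α - 1)) := by
  have hp : 0 < 1 / (α - 1) := one_div_pos.2 (by linarith)
  refine le_antisymm (sSup_le ?_) (le_of_forall_lt fun c hc => ?_)
  · rintro _ ⟨s, ⟨_, hs⟩, rfl⟩
    refine ENNReal.ofReal_le_ofReal (not_lt.1 fun h => ?_)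
    exact ((genHausdorff_bcube_le_one hα h).trans_lt ENNReal.one_lt_top).ne hs
  · have hc' : c.toReal < 1 / (α - 1) := (ENNReal.lt_ofReal_iff_toReal_lt hc.ne_top).1 hc
    obtain ⟨s, hcs, hsp⟩ := exists_between hc'
    have hs : 0 < s := ENNReal.toReal_nonneg.trans_lt hcs
    refine lt_of_lt_of_le ?_ (le_sSup ⟨s, ⟨hs, genHausdorff_bcube_eq_top hα hs hsp⟩, rfl⟩)
    exact (ENNReal.lt_ofReal_iff_toReal_lt hc.ne_top).2 hcs
end

section
/- There exists a compact metric space X with lower Minkowski dimension equal to 1 (in particular positive) such that for every d' > 0 and every C > 0 there is no sequence (q_i)_{i≥1} of points of X with d(q_i, q_j) ≥ C·i^{−1/d'} for all integers 1 ≤ i < j; that is, for every sequence (q_i)_{i≥1} in X there exist i < j with d(q_i, q_j) < C·i^{−1/d'}. -/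
open scoped ENNReal NNReal

/-- `coverN S ε` : minimal number of closed balls of radius `ε` needed to cover `S`
(`∞` if no finite cover exists). -/
noncomputable def coverN {Z : Type*} [MetricSpace Z] (S : Set Z) (ε : ℝ) : ℝ≥0∞ :=
  ⨅ (F : Finset Z) (_ : S ⊆ ⋃ x ∈ F, Metric.closedBall x ε), (F.card : ℝ≥0∞)

/-- The lower Minkowski (box-counting) dimension of a set. -/
noncomputable def lowerMinkDim {Z : Type*} [MetricSpace Z] (S : Set Z) : ℝ :=
  Filter.liminf (fun ε : ℝ => Real.log (coverN S ε).toReal / Real.log (1 / ε))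
    (nhdsWithin 0 (Set.Ioi 0))

namespace WanderingTree

open Filter Topology

/-- The pair `(p, c)` scheduled at level `k`; every pair is scheduled on infinitely many
intervals of the form `[a, a ^ 2)`. -/
def schedule (k : ℕ) : ℕ × ℕ :=
  Nat.unpair (Nat.unpair (Nat.log 2 (Nat.log 2 k))).1

/-- The only node at level `k` of the tree that branches. -/
def node (k : ℕ) : ℕ → ℕ :=
  if _h : (schedule k).1 < k then
    Function.update (node (schedule k).1) (schedule k).1
      ((schedule k).2 % 2 ^ ((schedule k).1 + 1))
  else 0
termination_by k

/-- The set of ends of the tree in which, at level `k`, the node `node k` has `2 ^ (k + 1)`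
children and any other node has one child. -/
def ends : Set (ℕ → ℕ) :=
  {x | ∀ k, x k < 2 ^ (k + 1) ∧ (x k ≠ 0 → ∀ i < k, x i = node k i)}

lemma node_zero : node 0 = 0 := by
  rw [node]; simp

lemma node_apply_eq_zero (k : ℕ) : ∀ i, k ≤ i → node k i = 0 := by
  induction k using Nat.strong_induction_on with
  | _ k ih =>
    intro i hi
    rw [node]
    split_ifs with h
    · rw [Function.update_of_ne (by omega)]
      exact ih _ h i (by omega)
    · rfl

lemma update_mem {k c : ℕ} (hk : node k ∈ ends) (hc : c < 2 ^ (k + 1)) :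
    Function.update (node k) k c ∈ ends := by
  intro l
  rcases lt_trichotomy l k with h | rfl | h
  · rw [Function.update_of_ne h.ne]
    refine ⟨(hk l).1, fun hl i hi => ?_⟩
    rw [Function.update_of_ne (by omega)]
    exact (hk l).2 hl i hi
  · rw [Function.update_self]
    refine ⟨hc, fun _ i hi => ?_⟩
    rw [Function.update_of_ne hi.ne]
  · rw [Function.update_of_ne h.ne', node_apply_eq_zero k l h.le]
    exact ⟨by positivity, fun h => absurd rfl h⟩

lemma zero_mem : (0 : ℕ → ℕ) ∈ ends := fun _ => ⟨by simp, fun h => absurd rfl h⟩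

lemma node_mem (k : ℕ) : node k ∈ ends := by
  induction k using Nat.strong_induction_on with
  | _ k ih =>
    rw [node]
    split_ifs with h
    · exact update_mem (ih _ h) (Nat.mod_lt _ (by positivity))
    · exact zero_mem

lemma schedule_eq {p c J k : ℕ} (h₁ : 2 ^ 2 ^ Nat.pair (Nat.pair p c) J ≤ k)
    (h₂ : k < (2 ^ 2 ^ Nat.pair (Nat.pair p c) J) ^ 2) : schedule k = (p, c) := by
  have hk : Nat.log 2 (Nat.log 2 k) = Nat.pair (Nat.pair p c) J := by
    rw [← pow_mul, ← pow_succ] at h₂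
    have hk0 : k ≠ 0 := by
      have : 0 < 2 ^ 2 ^ Nat.pair (Nat.pair p c) J := by positivity
      omega
    have h3 := Nat.le_log_of_pow_le one_lt_two h₁
    have h4 := Nat.log_lt_of_lt_pow hk0 h₂
    exact Nat.log_eq_of_pow_le_of_lt_pow h3 h4
  simp [schedule, hk]

lemma node_eq {p c J k : ℕ} (hc : c < 2 ^ (p + 1))
    (h₁ : 2 ^ 2 ^ Nat.pair (Nat.pair p c) J ≤ k)
    (h₂ : k < (2 ^ 2 ^ Nat.pair (Nat.pair p c) J) ^ 2) :
    node k = Function.update (node p) p c := by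
  have hp : p < k := calc
    p ≤ Nat.pair p c := Nat.left_le_pair _ _
    _ ≤ Nat.pair (Nat.pair p c) J := Nat.left_le_pair _ _
    _ < 2 ^ Nat.pair (Nat.pair p c) J := Nat.lt_two_pow_self
    _ < 2 ^ 2 ^ Nat.pair (Nat.pair p c) J := Nat.lt_two_pow_self
    _ ≤ k := h₁
  rw [node]
  simp [schedule_eq h₁ h₂, hp, Nat.mod_eq_of_lt hc]

open Classical in
/-- The sequences in `ends` that vanish from index `k` on. -/
noncomputable def endsUpTo : ℕ → Finset (ℕ → ℕ)
  | 0 => {0}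
  | k + 1 => endsUpTo k ∪ (Finset.range (2 ^ (k + 1))).image (Function.update (node k) k)

lemma card_endsUpTo (k : ℕ) : (endsUpTo k).card < 2 ^ (k + 1) := by
  classical
  induction k with
  | zero => simp [endsUpTo]
  | succ k ih =>
    have h₁ := Finset.card_union_le (endsUpTo k)
      ((Finset.range (2 ^ (k + 1))).image (Function.update (node k) k))
    have h₂ : ((Finset.range (2 ^ (k + 1))).image (Function.update (node k) k)).card ≤ 2 ^ (k + 1) :=
      Finset.card_image_le.trans (by simp)
    rw [endsUpTo, pow_succ 2 (k + 1)]
    omega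

lemma exists_of_mem_endsUpTo {k : ℕ} {x : ℕ → ℕ} (hx : x ∈ endsUpTo k) :
    ∃ p c, c < 2 ^ (p + 1) ∧ x = Function.update (node p) p c := by
  classical
  induction k with
  | zero =>
    refine ⟨0, 0, by simp, ?_⟩
    rw [endsUpTo, Finset.mem_singleton] at hx
    simp [hx, node_zero]
  | succ k ih =>
    rw [endsUpTo, Finset.mem_union, Finset.mem_image] at hx
    rcases hx with h | ⟨c, hc, rfl⟩
    · exact ih h
    · exact ⟨k, c, Finset.mem_range.1 hc, rfl⟩

lemma endsUpTo_subset {k : ℕ} {x : ℕ → ℕ} (hx : x ∈ endsUpTo k) : x ∈ ends := by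
  obtain ⟨p, c, hc, rfl⟩ := exists_of_mem_endsUpTo hx
  exact update_mem (node_mem p) hc

/-- Replace by `0` all entries of index at least `k`. -/
def trunc (x : ℕ → ℕ) (k : ℕ) : ℕ → ℕ := fun i => if i < k then x i else 0

lemma trunc_apply {x : ℕ → ℕ} {k i : ℕ} (h : i < k) : trunc x k i = x i := if_pos h

lemma trunc_mem_endsUpTo {x : ℕ → ℕ} (hx : x ∈ ends) (k : ℕ) : trunc x k ∈ endsUpTo k := by
  classical
  induction k with
  | zero =>
    rw [endsUpTo, Finset.mem_singleton]
    ext i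
    simp [trunc]
  | succ k ih =>
    rw [endsUpTo, Finset.mem_union, Finset.mem_image]
    by_cases h : x k = 0
    · left
      convert ih using 1
      ext i
      rcases lt_trichotomy i k with hi | rfl | hi
      · rw [trunc_apply hi, trunc_apply (by omega)]
      · simp [trunc, h]
      · simp [trunc, show ¬ i < k by omega, show ¬ i < k + 1 by omega]
    · right
      refine ⟨x k, Finset.mem_range.2 (hx k).1, ?_⟩
      ext i
      rcases lt_trichotomy i k with hi | rfl | hi
      · rw [Function.update_of_ne hi.ne, trunc_apply (by omega), (hx k).2 h i hi]
      · simp [trunc]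
      · rw [Function.update_of_ne hi.ne', node_apply_eq_zero k i hi.le]
        simp [trunc, show ¬ i < k + 1 by omega]

/-- Every cylinder around a point of `ends` contains all branching nodes of level in `[a, a ^ 2)`,
for arbitrarily large `a`. -/
lemma exists_node_eq {x : ℕ → ℕ} (hx : x ∈ ends) (K J : ℕ) :
    ∃ a, J ≤ a ∧ ∀ k, a ≤ k → k < a ^ 2 → ∀ i < K, node k i = x i := by
  obtain ⟨p, c, hc, h⟩ := exists_of_mem_endsUpTo (trunc_mem_endsUpTo hx K)
  refine ⟨2 ^ 2 ^ Nat.pair (Nat.pair p c) J, ?_, fun k h₁ h₂ i hi => ?_⟩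
  · calc
      J ≤ Nat.pair (Nat.pair p c) J := Nat.right_le_pair _ _
      _ ≤ 2 ^ Nat.pair (Nat.pair p c) J := Nat.lt_two_pow_self.le
      _ ≤ 2 ^ 2 ^ Nat.pair (Nat.pair p c) J := Nat.lt_two_pow_self.le
  · rw [node_eq hc h₁ h₂, ← h, trunc_apply hi]

lemma isClosed_ends : IsClosed ends := by
  have : ends = ⋂ k, ({x : ℕ → ℕ | x k < 2 ^ (k + 1)} ∩
      ({x | x k = 0} ∪ ⋂ i, ⋂ (_ : i < k), {x | x i = node k i})) := by
    ext x
    simp only [ends, Set.mem_ofPred_eq, Set.mem_iInter, Set.mem_inter_iff, Set.mem_union]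
    refine forall_congr' fun k => and_congr_right fun _ => ?_
    tauto
  rw [this]
  have hc (i : ℕ) : Continuous fun x : ℕ → ℕ => x i := continuous_apply i
  refine isClosed_iInter fun k => IsClosed.inter ?_ (IsClosed.union ?_ ?_)
  · exact (isClosed_discrete (Set.Iio (2 ^ (k + 1)))).preimage (hc k)
  · exact isClosed_eq (hc k) continuous_const
  · exact isClosed_iInter fun i => isClosed_iInter fun _ => isClosed_eq (hc i) continuous_const

lemma isCompact_ends : IsCompact ends := by
  refine (isCompact_univ_pi fun k => (Set.finite_Iio (2 ^ (k + 1))).isCompact).of_isClosed_subset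
    isClosed_ends ?_
  intro x hx k _
  exact (hx k).1

attribute [local instance] PiNat.metricSpaceNatNat

lemma dist_le_iff {x y : ℕ → ℕ} {n : ℕ} :
    dist x y ≤ (1 / 2) ^ n ↔ ∀ i < n, x i = y i := by
  rw [← PiNat.mem_cylinder_iff_dist_le, PiNat.mem_cylinder_iff]

lemma coverN_le {ε : ℝ} {k : ℕ} (hε : (1 / 2) ^ k ≤ ε) :
    coverN (Set.univ : Set ends) ε ≤ (2 ^ (k + 1) : ℕ) := by
  classical
  refine (iInf₂_le ((endsUpTo k).attach.image
    fun x => (⟨x.1, endsUpTo_subset x.2⟩ : ends)) ?_).trans ?_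
  · intro x _
    simp only [Set.mem_iUnion]
    refine ⟨⟨trunc x.1 k, endsUpTo_subset (trunc_mem_endsUpTo x.2 k)⟩, ?_, ?_⟩
    · exact Finset.mem_image.2 ⟨⟨_, trunc_mem_endsUpTo x.2 k⟩, Finset.mem_attach _ _, rfl⟩
    · rw [Metric.mem_closedBall, Subtype.dist_eq]
      exact (dist_le_iff.2 fun i hi => (trunc_apply hi).symm).trans hε
  · have := card_endsUpTo k
    exact_mod_cast Finset.card_image_le.trans (by rw [Finset.card_attach]; omega)

lemma le_coverN {ε : ℝ} {k : ℕ} (hε : ε < (1 / 2) ^ k) :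
    (2 ^ (k + 1) : ℕ) ≤ coverN (Set.univ : Set ends) ε := by
  refine le_iInf₂ fun F hF => ?_
  have key (c : ℕ) (hc : c < 2 ^ (k + 1)) :
      ∃ x ∈ F, dist (Function.update (node k) k c) x.1 ≤ ε := by
    have := hF (Set.mem_univ ⟨_, update_mem (node_mem k) hc⟩)
    simpa [Set.mem_iUnion, Metric.mem_closedBall, Subtype.dist_eq] using this
  have : Nonempty ends := ⟨⟨0, zero_mem⟩⟩
  choose! g hg hgε using key
  have hinj : Set.InjOn g (Finset.range (2 ^ (k + 1)) : Set ℕ) := by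
    intro c hc c' hc' h
    have hc := Finset.mem_range.1 hc
    have hc' := Finset.mem_range.1 hc'
    have h₁ := hgε c hc
    have h₂ := hgε c' hc'
    rw [← h, dist_comm] at h₂
    by_contra hne
    have hd := (PiNat.dist_triangle_nonarch (Function.update (node k) k c) (g c).1
      (Function.update (node k) k c')).trans (max_le h₁ h₂)
    have hne' : Function.update (node k) k c ≠ Function.update (node k) k c' := by
      intro h
      exact hne (by simpa using congrFun h k)
    have hfd : PiNat.firstDiff (Function.update (node k) k c) (Function.update (node k) k c') ≤ k :=
      not_lt.1 fun hlt => hne (by simpa using PiNat.apply_eq_of_lt_firstDiff hlt)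
    rw [PiNat.dist_eq_of_ne hne'] at hd
    have := pow_le_pow_of_le_one (by norm_num : (0 : ℝ) ≤ 1 / 2) (by norm_num) hfd
    linarith
  have := Finset.card_le_card_of_injOn g
    (fun c hc => hg c (Finset.mem_range.1 hc)) hinj
  rw [Finset.card_range] at this
  exact_mod_cast this

lemma coverN_mem_Icc {ε : ℝ} (h₀ : 0 < ε) (h₁ : ε < 1) :
    (coverN (Set.univ : Set ends) ε).toReal ∈ Set.Icc (1 / ε) (4 / ε) := by
  obtain ⟨k, hk, hk'⟩ : ∃ k : ℕ, (1 / 2) ^ (k + 1) ≤ ε ∧ ε < (1 / 2 : ℝ) ^ k := by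
    have hex : ∃ k : ℕ, (1 / 2 : ℝ) ^ k ≤ ε :=
      (exists_pow_lt_of_lt_one h₀ (by norm_num : (1 / 2 : ℝ) < 1)).imp fun _ => le_of_lt
    classical
    have hpos : Nat.find hex ≠ 0 := by
      intro h
      have := Nat.find_spec hex
      rw [h, pow_zero] at this
      linarith
    obtain ⟨k, hk⟩ := Nat.exists_eq_succ_of_ne_zero hpos
    have hspec := Nat.find_spec hex
    rw [hk] at hspec
    exact ⟨k, hspec, not_le.1 (Nat.find_min hex (by omega))⟩
  have hu := coverN_le hk
  have hl := le_coverN hk'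
  have hfin : coverN (Set.univ : Set ends) ε ≠ ⊤ := ne_top_of_le_ne_top (ENNReal.natCast_ne_top _) hu
  have hu' := ENNReal.toReal_mono (ENNReal.natCast_ne_top _) hu
  have hl' := ENNReal.toReal_mono hfin hl
  rw [ENNReal.toReal_natCast] at hu' hl'
  push_cast at hu' hl'
  have h2 : (0 : ℝ) < 2 ^ k := by positivity
  rw [one_div_pow, div_le_iff₀ (by positivity), pow_succ] at hk
  rw [one_div_pow, lt_div_iff₀ h2] at hk'
  rw [pow_succ] at hl'
  rw [pow_succ, pow_succ] at hu'
  constructor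
  · rw [div_le_iff₀ h₀]
    nlinarith
  · rw [le_div_iff₀ h₀]
    nlinarith

lemma lowerMinkDim_ends : lowerMinkDim (Set.univ : Set ends) = 1 := by
  have hlog : Tendsto (fun ε : ℝ => Real.log (1 / ε)) (𝓝[>] 0) atTop := by
    simpa only [one_div, Function.comp_def] using Real.tendsto_log_atTop.comp tendsto_inv_nhdsGT_zero
  have hub : Tendsto (fun ε : ℝ => 1 + Real.log 4 / Real.log (1 / ε)) (𝓝[>] 0) (𝓝 1) := by
    simpa using (hlog.const_div_atTop (Real.log 4)).const_add 1
  refine Tendsto.liminf_eq (tendsto_of_tendsto_of_tendsto_of_le_of_le' tendsto_const_nhds hub ?_ ?_)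
  all_goals
    filter_upwards [Ioo_mem_nhdsGT (zero_lt_one' ℝ)] with ε ⟨h₀, h₁⟩
    obtain ⟨hl, hu⟩ := coverN_mem_Icc h₀ h₁
    have hpos : 0 < Real.log (1 / ε) := Real.log_pos ((one_lt_div h₀).2 h₁)
    have hi : 0 < 1 / ε := by positivity
  · rw [le_div_iff₀ hpos, one_mul]
    exact Real.log_le_log hi hl
  · rw [div_le_iff₀ hpos, add_mul, one_mul, div_mul_cancel₀ _ hpos.ne', add_comm,
      ← Real.log_mul (by norm_num) hi.ne', mul_one_div]
    exact Real.log_le_log (hi.trans_le hl) hu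

/-- Points of `ends` outside a cylinder which contains the branching nodes of level in `[a, b)`
are constant zero on `[a, b)`. -/
lemma apply_eq_zero {x y : ℕ → ℕ} {K a b : ℕ} (hy : y ∈ ends) (hK : K ≤ a)
    (hnode : ∀ k, a ≤ k → k < b → ∀ i < K, node k i = x i) (hxy : ∃ i < K, x i ≠ y i)
    {k : ℕ} (hak : a ≤ k) (hkb : k < b) : y k = 0 := by
  by_contra h
  obtain ⟨i, hi, hne⟩ := hxy
  exact hne (((hy k).2 h i (by omega)).trans (hnode k hak hkb i hi)).symm

lemma eventually_lt (s C : ℝ) (hC : 0 < C) :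
    ∀ᶠ a : ℕ in atTop, (1 / 2 : ℝ) ^ (a ^ 2) < C * ((2 : ℝ) ^ (a + 3)) ^ (-s) := by
  have h : Tendsto (fun a : ℕ => (a : ℝ) * (a - s)) atTop atTop :=
    tendsto_natCast_atTop_atTop.atTop_mul_atTop₀
      (tendsto_atTop_add_const_right _ _ tendsto_natCast_atTop_atTop)
  filter_upwards [h.eventually_gt_atTop (3 * s - Real.logb 2 C)] with a ha
  have hC' : C = (2 : ℝ) ^ Real.logb 2 C := (Real.rpow_logb (by norm_num) (by norm_num) hC).symm
  rw [hC', ← Real.rpow_natCast 2 (a + 3), ← Real.rpow_mul (by norm_num),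
    ← Real.rpow_add (by norm_num), one_div, inv_pow, ← Real.rpow_natCast,
    ← Real.rpow_neg (by norm_num)]
  apply Real.rpow_lt_rpow_of_exponent_lt (by norm_num)
  push_cast
  nlinarith

lemma exists_dist_lt {s C : ℝ} (hs : 0 < s) (hC : 0 < C) (q : ℕ → ends) :
    ∃ i j : ℕ, 1 ≤ i ∧ i < j ∧ dist (q i) (q j) < C * (i : ℝ) ^ (-s) := by
  by_contra! hq
  obtain ⟨K, hK⟩ := exists_pow_lt_of_lt_one hC (by norm_num : (1 / 2 : ℝ) < 1)
  obtain ⟨J, hJ⟩ := eventually_atTop.1 (eventually_lt s C hC)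
  obtain ⟨a, ha, hnode⟩ := exists_node_eq (q 1).2 K (max K J)
  have hout (j : ℕ) (hj : 1 < j) : ∃ i < K, (q 1).1 i ≠ (q j).1 i := by
    by_contra! h
    have h₁ := hq 1 j le_rfl hj
    rw [Nat.cast_one, Real.one_rpow, mul_one, Subtype.dist_eq] at h₁
    linarith [dist_le_iff.2 h]
  obtain ⟨i, hi, j, hj, hne, hij⟩ := Finset.exists_ne_map_eq_of_card_lt_of_maps_to
    (s := Finset.Ico 2 (2 ^ (a + 1) + 2)) (t := endsUpTo a) (f := fun j => trunc (q j).1 a)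
    (by simpa using card_endsUpTo a) (fun j _ => trunc_mem_endsUpTo (q j).2 a)
  wlog hlt : i < j generalizing i j
  · exact this j hj i hi hne.symm hij.symm (by omega)
  rw [Finset.mem_Ico] at hi hj
  have hagree : ∀ k < a ^ 2, (q i).1 k = (q j).1 k := by
    intro k hk
    rcases lt_or_ge k a with hka | hka
    · simpa only [trunc_apply hka] using congrFun hij k
    · have hKa : K ≤ a := (le_max_left _ _).trans ha
      rw [apply_eq_zero (q i).2 hKa hnode (hout i (by omega)) hka hk,
        apply_eq_zero (q j).2 hKa hnode (hout j (by omega)) hka hk]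
  have h₁ := hq i j (by omega) hlt
  have h₂ := hJ a ((le_max_right _ _).trans ha)
  have h₃ : ((2 : ℝ) ^ (a + 3)) ^ (-s) ≤ (i : ℝ) ^ (-s) := by
    apply Real.rpow_le_rpow_of_nonpos (by exact_mod_cast (by omega : 0 < i)) _ (by linarith)
    have h4 : 2 ≤ 2 ^ (a + 1) := le_self_pow (by norm_num) (by norm_num)
    have : i ≤ 2 ^ (a + 3) := by
      rw [show a + 3 = a + 1 + 2 from rfl, pow_add 2 (a + 1)]
      omega
    exact_mod_cast this
  have h₅ := dist_le_iff.2 hagree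
  rw [← Subtype.dist_eq] at h₅
  have h₆ := mul_le_mul_of_nonneg_left h₃ hC.le
  linarith

end WanderingTree

/-- Corollary 7.2: there is a compact metric space of lower Minkowski dimension `1`
containing no sequence `(q_i)_{i ≥ 1}` with `dist (q i) (q j) ≥ C i^{-1/d'}` for `i < j`. -/
theorem exists_space_without_separated_sequence :
    ∃ (X : Type) (_ : MetricSpace X), CompactSpace X ∧
      lowerMinkDim (Set.univ : Set X) = 1 ∧
      ∀ d' : ℝ, 0 < d' → ∀ C : ℝ, 0 < C → ∀ q : ℕ → X,
        ∃ i j : ℕ, 1 ≤ i ∧ i < j ∧ dist (q i) (q j) < C * (i : ℝ) ^ (-(1 / d')) := by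
  let _ : MetricSpace (ℕ → ℕ) := PiNat.metricSpaceNatNat
  exact ⟨WanderingTree.ends, inferInstance, isCompact_iff_compactSpace.1 WanderingTree.isCompact_ends,
    WanderingTree.lowerMinkDim_ends,
    fun d' hd' C hC q => WanderingTree.exists_dist_lt (by positivity) hC q⟩
end
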